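/- Let n ≥ 1, let E be an irreflexive acyclic relation on Fin n, let C be a weight matrix for E and let C* be its Kleene star. Then for every vector x : Fin n → ℝ with x i > 0 for all i, the following are equivalent: (1) x_j ≥ C i j · x_i for every pair (i,j) with E i j; (2) there exists λ : Fin n → ℝ with λ i > 0 for all i such that x_j = max_{1 ≤ i ≤ n} λ_i · C* i j for every j. (That is, the polytrope Q(C) equals the tropical convex hull of the rows of the Kleene star C*.) -/

import Mathlib

open Finset MeasureTheory ProbabilityTheory Real
open scoped ENNReal NNReal

/-- A directed path from `i` to `j` (of length `ℓ ≥ 1`) with weight `w`: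
the product of the edge weights along the path. -/
def PathWeight {n : ℕ} (E : Fin n → Fin n → Prop) (C : Fin n → Fin n → ℝ)
    (i j : Fin n) (w : ℝ) : Prop :=
  ∃ (ℓ : ℕ) (v : ℕ → Fin n), 1 ≤ ℓ ∧ v 0 = i ∧ v ℓ = j ∧
    (∀ k < ℓ, E (v k) (v (k + 1))) ∧
    w = ∏ k ∈ Finset.range ℓ, C (v k) (v (k + 1))

/-- The relation `E` has no directed cycles. -/
def Acyclic {n : ℕ} (E : Fin n → Fin n → Prop) : Prop :=
  ∀ i : Fin n, ¬ ∃ (ℓ : ℕ) (v : ℕ → Fin n), 1 ≤ ℓ ∧ v 0 = i ∧ v ℓ = i ∧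
    ∀ k < ℓ, E (v k) (v (k + 1))

/-- `C` is a weight matrix for the edge relation `E`. -/
structure IsWeightMatrix {n : ℕ} (E : Fin n → Fin n → Prop) (C : Fin n → Fin n → ℝ) : Prop where
  diag : ∀ i, C i i = 1
  edge_pos : ∀ i j, E i j → 0 < C i j
  nonedge : ∀ i j, i ≠ j → ¬ E i j → C i j = 0

/-- `S` is the Kleene star of the weight matrix `C`: `S i i = 1`, and for `i ≠ j`,
`S i j` is the maximum weight of a directed path from `i` to `j` if one exists, else `0`. -/
def IsKleeneStar {n : ℕ} (E : Fin n → Fin n → Prop) (C S : Fin n → Fin n → ℝ) : Prop :=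
  (∀ i, S i i = 1) ∧
  ∀ i j : Fin n, i ≠ j →
    ((∃ w, PathWeight E C i j w) →
      PathWeight E C i j (S i j) ∧ ∀ w, PathWeight E C i j w → w ≤ S i j) ∧
    ((¬ ∃ w, PathWeight E C i j w) → S i j = 0)

theorem pathWeight_nonneg {n : ℕ} {E : Fin n → Fin n → Prop} {C : Fin n → Fin n → ℝ}
    (hC : IsWeightMatrix E C) {i j : Fin n} {w : ℝ} (h : PathWeight E C i j w) : 0 ≤ w := by
  obtain ⟨l, v, -, -, -, he, rfl⟩ := h
  exact Finset.prod_nonneg fun k hk => (hC.edge_pos _ _ (he k (Finset.mem_range.1 hk))).le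

theorem star_nonneg {n : ℕ} {E : Fin n → Fin n → Prop} {C S : Fin n → Fin n → ℝ}
    (hC : IsWeightMatrix E C) (hS : IsKleeneStar E C S) (i j : Fin n) : 0 ≤ S i j := by
  by_cases hij : i = j
  · subst hij
    rw [hS.1]
    exact zero_le_one
  · by_cases h : ∃ w, PathWeight E C i j w
    · exact pathWeight_nonneg hC (((hS.2 i j hij).1 h).1)
    · exact ((hS.2 i j hij).2 h).ge

theorem pathWeight_single {n : ℕ} {E : Fin n → Fin n → Prop} {C : Fin n → Fin n → ℝ}
    {a b : Fin n} (h : E a b) : PathWeight E C a b (C a b) := by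
  refine ⟨1, fun k => if k = 0 then a else b, le_rfl, by simp, by simp, ?_, by simp⟩
  intro k hk
  obtain rfl : k = 0 := by omega
  simpa using h

theorem pathWeight_extend {n : ℕ} {E : Fin n → Fin n → Prop} {C : Fin n → Fin n → ℝ}
    {i a b : Fin n} {w : ℝ} (hw : PathWeight E C i a w) (h : E a b) :
    PathWeight E C i b (w * C a b) := by
  obtain ⟨l, v, hl, h0, h1, he, rfl⟩ := hw
  refine ⟨l + 1, fun k => if k ≤ l then v k else b, by omega, by simpa using h0, by simp, ?_, ?_⟩
  · intro k hk
    rcases Nat.lt_succ_iff_lt_or_eq.1 hk with hk | rfl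
    · have h2 : k + 1 ≤ l := hk
      simpa [hk.le, h2] using he k hk
    · simpa [h1] using h
  · rw [Finset.prod_range_succ]
    congr 1
    · refine Finset.prod_congr rfl fun k hk => ?_
      have hk := Finset.mem_range.1 hk
      have h2 : k + 1 ≤ l := hk
      simp [hk.le, h2]
    · simp [h1]

theorem path_bound {n : ℕ} {E : Fin n → Fin n → Prop} {C : Fin n → Fin n → ℝ}
    (hC : IsWeightMatrix E C) {x : Fin n → ℝ}
    (hE : ∀ i j : Fin n, E i j → C i j * x i ≤ x j) (v : ℕ → Fin n) (l : ℕ)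
    (he : ∀ k < l, E (v k) (v (k + 1))) :
    x (v 0) * ∏ k ∈ Finset.range l, C (v k) (v (k + 1)) ≤ x (v l) := by
  induction l with
  | zero => simp
  | succ l ih =>
    have h1 := ih fun k hk => he k (by omega)
    have h2 := he l (by omega)
    rw [Finset.prod_range_succ]
    have h3 := mul_le_mul_of_nonneg_left h1 (hC.edge_pos _ _ h2).le
    have h4 := hE _ _ h2
    linarith

theorem star_step {n : ℕ} {E : Fin n → Fin n → Prop} (hirr : ∀ i, ¬ E i i) (hacyc : Acyclic E)
    {C S : Fin n → Fin n → ℝ} (hC : IsWeightMatrix E C) (hS : IsKleeneStar E C S)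
    (i a b : Fin n) (h : E a b) : S i a * C a b ≤ S i b := by
  have key : ∀ w, PathWeight E C i b w → w ≤ S i b := by
    intro w hw
    have hib : i ≠ b := by
      rintro rfl
      obtain ⟨l, v, h1, h2, h3, h4, -⟩ := hw
      exact hacyc i ⟨l, v, h1, h2, h3, h4⟩
    exact ((hS.2 i b hib).1 ⟨w, hw⟩).2 w hw
  by_cases hia : i = a
  · subst hia
    rw [hS.1, one_mul]
    exact key _ (pathWeight_single h)
  · by_cases hp : ∃ w, PathWeight E C i a w
    · exact key _ (pathWeight_extend ((hS.2 i a hia).1 hp).1 h)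
    · rw [(hS.2 i a hia).2 hp, zero_mul]
      exact star_nonneg hC hS i b

/-- The polytrope `Q(C)` equals the tropical convex hull of the rows of the Kleene star `C*`. -/
theorem stmt5 {n : ℕ} (hn : 1 ≤ n) (E : Fin n → Fin n → Prop)
    (hirr : ∀ i, ¬ E i i) (hacyc : Acyclic E)
    (C S : Fin n → Fin n → ℝ) (hC : IsWeightMatrix E C) (hS : IsKleeneStar E C S)
    (x : Fin n → ℝ) (hx : ∀ i, 0 < x i) :
    (∀ i j : Fin n, E i j → C i j * x i ≤ x j) ↔
    (∃ lam : Fin n → ℝ, (∀ i, 0 < lam i) ∧ ∀ j : Fin n, x j = ⨆ i : Fin n, lam i * S i j) := by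
  haveI : Nonempty (Fin n) := ⟨⟨0, hn⟩⟩
  constructor
  · intro hE
    refine ⟨x, hx, fun j => le_antisymm ?_ (ciSup_le fun i => ?_)⟩
    · have h := le_ciSup (f := fun i => x i * S i j) (Set.finite_range _).bddAbove j
      simpa [hS.1] using h
    · by_cases hij : i = j
      · subst hij
        simp [hS.1]
      · by_cases hp : ∃ w, PathWeight E C i j w
        · obtain ⟨l, v, -, rfl, rfl, he, hw⟩ := ((hS.2 i j hij).1 hp).1
          rw [hw]
          exact path_bound hC hE v l he
        · rw [(hS.2 i j hij).2 hp, mul_zero]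
          exact (hx j).le
  · rintro ⟨lam, hl, hsup⟩ a b hab
    obtain ⟨i, hi⟩ := exists_eq_ciSup_of_finite (f := fun i => lam i * S i a)
    have h1 : x a = lam i * S i a := by rw [hsup a, ← hi]
    have h2 : lam i * S i b ≤ x b := by
      rw [hsup b]
      exact le_ciSup (f := fun i => lam i * S i b) (Set.finite_range _).bddAbove i
    have h3 := mul_le_mul_of_nonneg_left (star_step hirr hacyc hC hS i a b hab) (hl i).le
    rw [h1]
    linarith
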